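/- For every A ∈ [0, max_{[0,R]} H], letting p_A^- and p_A^+ denote the smallest and largest solutions in [0,R] of H(p) = A, one has: sup_{y ∈ [0, p_A^+]} H(y) = max_{[0,R]} H; sup_{y ∈ [p_A^-, R]} H(y) = max_{[0,R]} H; sup_{y ∈ [0, p_A^-]} H(y) = A; and sup_{y ∈ [p_A^+, R]} H(y) = A. In particular, with H^+(p) = sup_{0 ≤ y ≤ p} H(y) and H^-(p) = sup_{p ≤ y ≤ R} H(y), one has min{A, H^+(p_A^+)} = A and min{A, H^-(p_A^-)} = A. -/

import Mathlib

open Set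

noncomputable section

/-- The set of solutions in `[0,R]` of `H p = A`. -/
def sols (H : ℝ → ℝ) (R A : ℝ) : Set ℝ := {p ∈ Icc 0 R | H p = A}

/-- `p_A^-`: the smallest solution in `[0,R]` of `H p = A`. -/
def pm (H : ℝ → ℝ) (R A : ℝ) : ℝ := sInf (sols H R A)

/-- `p_A^+`: the largest solution in `[0,R]` of `H p = A`. -/
def pp (H : ℝ → ℝ) (R A : ℝ) : ℝ := sSup (sols H R A)

/-- `H^+(p) = sup_{0 ≤ y ≤ p} H(y)`. -/
def Hplus (H : ℝ → ℝ) (p : ℝ) : ℝ := sSup (H '' Icc 0 p)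

/-- `H^-(p) = sup_{p ≤ y ≤ R} H(y)`. -/
def Hminus (H : ℝ → ℝ) (R p : ℝ) : ℝ := sSup (H '' Icc p R)

/-- The solution set of `H p = A` in `[0,R]` is compact. -/
lemma isCompact_sols {H : ℝ → ℝ} (hc : Continuous H) (R A : ℝ) : IsCompact (sols H R A) :=
  isCompact_Icc.inter_right (isClosed_singleton.preimage hc)

/-- suprema of `H` over the intervals determined by `p_A^-` and `p_A^+`,
and the consequences `min{A, H^+(p_A^+)} = A` and `min{A, H^-(p_A^-)} = A`. -/
theorem sup_over_subintervals
    (R : ℝ) (hR : 0 < R) (H : ℝ → ℝ) (hc : Continuous H)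
    (hconc : StrictConcaveOn ℝ (Icc 0 R) H) (h0 : H 0 = 0) (hRv : H R = 0) :
    ∀ A : ℝ, A ∈ Icc 0 (sSup (H '' Icc 0 R)) →
      sSup (H '' Icc 0 (pp H R A)) = sSup (H '' Icc 0 R) ∧
      sSup (H '' Icc (pm H R A) R) = sSup (H '' Icc 0 R) ∧
      sSup (H '' Icc 0 (pm H R A)) = A ∧
      sSup (H '' Icc (pp H R A) R) = A ∧
      min A (Hplus H (pp H R A)) = A ∧
      min A (Hminus H R (pm H R A)) = A := by
  rintro A ⟨hA0, hAM⟩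
  obtain ⟨m, hm, hmax⟩ := isCompact_Icc.exists_isMaxOn (nonempty_Icc.2 hR.le) hc.continuousOn
  have hM : sSup (H '' Icc 0 R) = H m :=
    IsGreatest.csSup_eq ⟨mem_image_of_mem H hm, forall_mem_image.2 hmax⟩
  rw [hM] at hAM ⊢
  have hcomp := isCompact_sols hc R A
  have left_sol : ∀ y ∈ Icc 0 R, A ≤ H y → pm H R A ≤ y := by
    intro y hy hAy
    obtain ⟨p, hp, hpA⟩ :=
      intermediate_value_Icc hy.1 hc.continuousOn
        (show A ∈ Icc (H 0) (H y) from ⟨h0.trans_le hA0, hAy⟩)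
    exact (csInf_le hcomp.bddBelow ⟨⟨hp.1, hp.2.trans hy.2⟩, hpA⟩).trans hp.2
  have right_sol : ∀ y ∈ Icc 0 R, A ≤ H y → ∃ p ∈ sols H R A, y ≤ p := by
    intro y hy hAy
    obtain ⟨p, hp, hpA⟩ :=
      intermediate_value_Icc' hy.2 hc.continuousOn
        (show A ∈ Icc (H R) (H y) from ⟨hRv.trans_le hA0, hAy⟩)
    exact ⟨p, ⟨⟨hy.1.trans hp.1, hp.2⟩, hpA⟩, hp.1⟩
  have right_sol_le : ∀ y ∈ Icc 0 R, A ≤ H y → y ≤ pp H R A := by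
    intro y hy hAy
    obtain ⟨p, hp, hyp⟩ := right_sol y hy hAy
    exact hyp.trans (le_csSup hcomp.bddAbove hp)
  have hne : (sols H R A).Nonempty := (right_sol m hm hAM).imp fun _ h => h.1
  obtain ⟨hpm, hpmA⟩ : pm H R A ∈ sols H R A := hcomp.sInf_mem hne
  obtain ⟨hpp, hppA⟩ : pp H R A ∈ sols H R A := hcomp.sSup_mem hne
  have sup_plus : sSup (H '' Icc 0 (pp H R A)) = H m :=
    IsGreatest.csSup_eq ⟨mem_image_of_mem H ⟨hm.1, right_sol_le m hm hAM⟩,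
      forall_mem_image.2 fun _ hy => hmax ⟨hy.1, hy.2.trans hpp.2⟩⟩
  have sup_minus : sSup (H '' Icc (pm H R A) R) = H m :=
    IsGreatest.csSup_eq ⟨mem_image_of_mem H ⟨left_sol m hm hAM, hm.2⟩,
      forall_mem_image.2 fun _ hy => hmax ⟨hpm.1.trans hy.1, hy.2⟩⟩
  refine ⟨sup_plus, sup_minus, ?_, ?_, ?_, ?_⟩
  · refine IsGreatest.csSup_eq ⟨⟨_, right_mem_Icc.2 hpm.1, hpmA⟩, forall_mem_image.2 ?_⟩
    intro y hy
    by_contra! hlt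
    have hle := left_sol y ⟨hy.1, hy.2.trans hpm.2⟩ hlt.le
    rw [le_antisymm hy.2 hle, hpmA] at hlt
    exact hlt.false
  · refine IsGreatest.csSup_eq ⟨⟨_, left_mem_Icc.2 hpp.2, hppA⟩, forall_mem_image.2 ?_⟩
    intro y hy
    by_contra! hlt
    have hle := right_sol_le y ⟨hpp.1.trans hy.1, hy.2⟩ hlt.le
    rw [le_antisymm hle hy.1, hppA] at hlt
    exact hlt.false
  · exact min_eq_left (hAM.trans_eq sup_plus.symm)
  · exact min_eq_left (hAM.trans_eq sup_minus.symm)
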